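/- arXiv:2506.18865 — 3 statements merged into one kernel-verified Lean document; each statement's English description precedes it below -/
import Mathlib

section
/- Let (x_j)_{j∈J} be a frame for H with frame bounds 0 < A ≤ B and frame operator S. Fix x ∈ H and a relaxation parameter α with 0 < α < 2/B. Define y₀ = 0 and, for n ≥ 0, y_{n+1} = y_n + α·S(x − y_n). Then for every n ≥ 0, ‖x − y_n‖ ≤ C_α^n · ‖x‖, where C_α := max(|1 − αA|, |1 − αB|) < 1; in particular y_n converges to x in norm as n → ∞. -/
noncomputable section

local notation "⟪" x ", " y "⟫" => @inner ℝ _ _ x y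

theorem summable_sq_inner_of_lower_bound
    {H : Type*} [NormedAddCommGroup H] [InnerProductSpace ℝ H] {J : Type*} {xj : J → H}
    {A : ℝ} (hA : 0 < A) (h : ∀ x : H, A * ‖x‖ ^ 2 ≤ ∑' j, ⟪x, xj j⟫ ^ 2) (x : H) :
    Summable fun j => ⟪x, xj j⟫ ^ 2 := by
  by_contra hs
  have hx := h x
  rw [tsum_eq_zero_of_not_summable hs] at hx
  have hx0 : x = 0 := by
    by_contra h0
    have : 0 < ‖x‖ := norm_pos_iff.mpr h0
    have : 0 < A * ‖x‖ ^ 2 := by positivity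
    linarith
  exact hs (by simp [hx0, summable_zero])

theorem norm_sq_sum_smul_le_of_bessel
    {H : Type*} [NormedAddCommGroup H] [InnerProductSpace ℝ H] {J : Type*} {xj : J → H}
    {B : ℝ} (h : ∀ (x : H) (F : Finset J), ∑ j ∈ F, ⟪x, xj j⟫ ^ 2 ≤ B * ‖x‖ ^ 2)
    (hB : 0 ≤ B) (c : J → ℝ) (F : Finset J) :
    ‖∑ j ∈ F, c j • xj j‖ ^ 2 ≤ B * ∑ j ∈ F, c j ^ 2 := by
  set v := ∑ j ∈ F, c j • xj j with hv
  have hinner : ‖v‖ ^ 2 = ∑ j ∈ F, c j * ⟪v, xj j⟫ := by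
    rw [← real_inner_self_eq_norm_sq]
    nth_rewrite 2 [hv]
    simp [inner_sum, inner_smul_right]
  have hc : 0 ≤ ∑ j ∈ F, c j ^ 2 := Finset.sum_nonneg fun _ _ => sq_nonneg _
  rcases eq_or_ne v 0 with h0 | h0
  · rw [h0]
    simpa using mul_nonneg hB hc
  have hpos : 0 < ‖v‖ ^ 2 := by
    have := norm_pos_iff.mpr h0
    positivity
  have hcs := Finset.sum_mul_sq_le_sq_mul_sq F c fun j => ⟪v, xj j⟫
  rw [← hinner] at hcs
  refine le_of_mul_le_mul_right ?_ hpos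
  calc ‖v‖ ^ 2 * ‖v‖ ^ 2 = (‖v‖ ^ 2) ^ 2 := by ring
    _ ≤ (∑ j ∈ F, c j ^ 2) * ∑ j ∈ F, ⟪v, xj j⟫ ^ 2 := hcs
    _ ≤ (∑ j ∈ F, c j ^ 2) * (B * ‖v‖ ^ 2) := mul_le_mul_of_nonneg_left (h v F) hc
    _ = B * (∑ j ∈ F, c j ^ 2) * ‖v‖ ^ 2 := by ring

theorem summable_smul_of_bessel
    {H : Type*} [NormedAddCommGroup H] [InnerProductSpace ℝ H] [CompleteSpace H]
    {J : Type*} {xj : J → H} {B : ℝ}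
    (h : ∀ (x : H) (F : Finset J), ∑ j ∈ F, ⟪x, xj j⟫ ^ 2 ≤ B * ‖x‖ ^ 2)
    (hB : 0 < B) {c : J → ℝ} (hc : Summable fun j => c j ^ 2) :
    Summable fun j => c j • xj j := by
  rw [summable_iff_vanishing_norm] at hc ⊢
  intro ε hε
  obtain ⟨F, hF⟩ := hc (ε ^ 2 / B) (by positivity)
  refine ⟨F, fun G hG => ?_⟩
  have h1 := (le_abs_self _).trans_lt (hF G hG)
  rw [lt_div_iff₀ hB] at h1
  have h2 := norm_sq_sum_smul_le_of_bessel h hB.le c G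
  exact lt_of_pow_lt_pow_left₀ 2 hε.le (by linarith)

theorem norm_le_of_symmetric_of_abs_inner_le
    {H : Type*} [NormedAddCommGroup H] [InnerProductSpace ℝ H] {T : H →L[ℝ] H}
    (hT : (T : H →ₗ[ℝ] H).IsSymmetric) {C : ℝ} (hC : 0 ≤ C)
    (h : ∀ x, |⟪T x, x⟫| ≤ C * ‖x‖ ^ 2) : ‖T‖ ≤ C := by
  rw [T.norm_eq_iSup_rayleighQuotient hT]
  refine ciSup_le fun x => ?_
  rw [ContinuousLinearMap.rayleighQuotient, abs_div, abs_sq,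
    ContinuousLinearMap.reApplyInnerSelf_apply]
  exact div_le_of_le_mul₀ (sq_nonneg _) hC (h x)

theorem norm_one_sub_smul_le
    {H : Type*} [NormedAddCommGroup H] [InnerProductSpace ℝ H] {S : H →L[ℝ] H}
    (hS : (S : H →ₗ[ℝ] H).IsSymmetric) {A B α : ℝ} (hα : 0 ≤ α)
    (hlower : ∀ x, A * ‖x‖ ^ 2 ≤ ⟪S x, x⟫) (hupper : ∀ x, ⟪S x, x⟫ ≤ B * ‖x‖ ^ 2) :
    ‖1 - α • S‖ ≤ max |1 - α * A| |1 - α * B| := by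
  refine norm_le_of_symmetric_of_abs_inner_le (fun x y => ?_)
    ((abs_nonneg _).trans (le_max_left _ _)) fun x => ?_
  · have := hS x y
    simp only [ContinuousLinearMap.coe_coe] at this
    simp [inner_sub_left, inner_sub_right, inner_smul_left, inner_smul_right, this]
  · have hx : ⟪(1 - α • S) x, x⟫ = ‖x‖ ^ 2 - α * ⟪S x, x⟫ := by
      simp [inner_sub_left, inner_smul_left]
    have h1 := mul_le_mul_of_nonneg_left (hlower x) hα
    have h2 := mul_le_mul_of_nonneg_left (hupper x) hα
    have h3 := mul_le_mul_of_nonneg_right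
      ((le_abs_self (1 - α * A)).trans (le_max_left _ |1 - α * B|)) (sq_nonneg ‖x‖)
    have h4 := mul_le_mul_of_nonneg_right
      ((neg_le_abs (1 - α * B)).trans (le_max_right |1 - α * A| _)) (sq_nonneg ‖x‖)
    rw [hx, abs_le]
    constructor <;> linarith

/-- **The Frame Algorithm.**  Let `(xj j)_{j ∈ J}` be a frame for a separable Hilbert
space `H` with frame bounds `0 < A ≤ B` and frame operator `S`.  Fix `x ∈ H` and a
relaxation parameter `α` with `0 < α < 2 / B`.  Define `y 0 = 0` and
`y (n+1) = y n + α • S (x - y n)`.  Then `‖x - y n‖ ≤ Cα ^ n * ‖x‖` where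
`Cα = max |1 - α * A| |1 - α * B| < 1`, and `y n → x`. -/
theorem frame_algorithm
    {H : Type*} [NormedAddCommGroup H] [InnerProductSpace ℝ H] [CompleteSpace H]
    {J : Type*} [Countable J] (xj : J → H)
    (A B : ℝ) (hA : 0 < A) (hAB : A ≤ B)
    (hframe : ∀ x : H,
      A * ‖x‖ ^ 2 ≤ ∑' j, ⟪x, xj j⟫ ^ 2 ∧ ∑' j, ⟪x, xj j⟫ ^ 2 ≤ B * ‖x‖ ^ 2)
    (S : H →L[ℝ] H) (hS : ∀ x : H, S x = ∑' j, ⟪x, xj j⟫ • xj j)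
    (x : H) (α : ℝ) (hα0 : 0 < α) (hα2 : α < 2 / B)
    (y : ℕ → H) (hy0 : y 0 = 0)
    (hy : ∀ n : ℕ, y (n + 1) = y n + α • S (x - y n)) :
    (∀ n : ℕ, ‖x - y n‖ ≤ (max |1 - α * A| |1 - α * B|) ^ n * ‖x‖) ∧
      max |1 - α * A| |1 - α * B| < 1 ∧
      Filter.Tendsto y Filter.atTop (nhds x) := by
  have hB : 0 < B := hA.trans_le hAB
  have hsq := summable_sq_inner_of_lower_bound hA fun x => (hframe x).1
  have hbessel : ∀ (x : H) (F : Finset J), ∑ j ∈ F, ⟪x, xj j⟫ ^ 2 ≤ B * ‖x‖ ^ 2 := fun x F =>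
    ((hsq x).sum_le_tsum F fun _ _ => sq_nonneg _).trans (hframe x).2
  have hSinner : ∀ u v : H, ⟪S u, v⟫ = ∑' j, ⟪u, xj j⟫ * ⟪v, xj j⟫ := fun u v => by
    rw [hS, real_inner_comm, ← innerSL_apply_apply ℝ,
      (innerSL ℝ v).map_tsum (summable_smul_of_bessel hbessel hB (hsq u))]
    simp
  have hSself : ∀ u : H, ⟪S u, u⟫ = ∑' j, ⟪u, xj j⟫ ^ 2 := fun u => by
    simp only [hSinner, sq]
  have hSsymm : (S : H →ₗ[ℝ] H).IsSymmetric := fun u v => by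
    simp only [ContinuousLinearMap.coe_coe]
    rw [real_inner_comm (S v) u, hSinner, hSinner]
    simp only [mul_comm]
  have hnorm : ‖1 - α • S‖ ≤ max |1 - α * A| |1 - α * B| :=
    norm_one_sub_smul_le hSsymm hα0.le (fun u => hSself u ▸ (hframe u).1)
      fun u => hSself u ▸ (hframe u).2
  have hC : max |1 - α * A| |1 - α * B| < 1 := by
    rw [lt_div_iff₀ hB] at hα2
    have hαA : 0 < α * A := mul_pos hα0 hA
    have hαAB : α * A ≤ α * B := mul_le_mul_of_nonneg_left hAB hα0.le
    exact max_lt (abs_lt.mpr ⟨by linarith, by linarith⟩) (abs_lt.mpr ⟨by linarith, by linarith⟩)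
  have hC0 : 0 ≤ max |1 - α * A| |1 - α * B| := (abs_nonneg _).trans (le_max_left _ _)
  have hbound : ∀ n : ℕ, ‖x - y n‖ ≤ (max |1 - α * A| |1 - α * B|) ^ n * ‖x‖ := by
    intro n
    induction n with
    | zero => simp [hy0]
    | succ n ih =>
      have hstep : x - y (n + 1) = (1 - α • S) (x - y n) := by
        rw [hy, sub_apply, one_apply_eq_self, smul_apply, sub_sub]
      rw [hstep, pow_succ', mul_assoc]
      exact (ContinuousLinearMap.le_opNorm _ _).trans
        (mul_le_mul hnorm ih (norm_nonneg _) hC0)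
  refine ⟨hbound, hC, ?_⟩
  rw [tendsto_iff_norm_sub_tendsto_zero]
  refine squeeze_zero (fun _ => norm_nonneg _)
    (fun n => (norm_sub_rev (y n) x).trans_le (hbound n)) ?_
  simpa using (tendsto_pow_atTop_nhds_zero_of_lt_one hC0 hC).mul_const ‖x‖
end
end

section
/- Let (x_j)_{j∈J} be a frame for H with frame bounds 0 < A ≤ B, analysis operator T, and frame operator S = T*T. Fix x ∈ H and δ₀ > 0, and let c ∈ ℓ²(J) satisfy ‖Tx − c‖ ≤ δ₀. Define y₀ = 0 and, for n ≥ 0, set α_n = ‖T*(c − Ty_n)‖² / ‖T*(c − Ty_n)‖_S² (when T*(c − Ty_n) ≠ 0) and y_{n+1} = y_n + α_n·T*(c − Ty_n). Then for every n ≥ 1, ‖x − y_n‖_S ≤ ((B − A)/(B + A))^n · (‖x‖_S + 2δ₀) + 2δ₀. -/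
noncomputable section

local notation "⟪" x ", " y "⟫" => @inner ℝ _ _ x y

open ContinuousLinearMap in
/-- If `A ‖w‖² ≤ ‖T w‖² ≤ B ‖w‖²`, then the form `w ↦ ‖T* T w‖²` lies between `A ‖T w‖²` and
`B ‖T w‖²`. -/
theorem norm_adjoint_comp_sq_bounds {H E : Type*} [NormedAddCommGroup H] [InnerProductSpace ℝ H]
    [CompleteSpace H] [NormedAddCommGroup E] [InnerProductSpace ℝ E] [CompleteSpace E]
    (T : H →L[ℝ] E) {A B : ℝ} (hA : 0 < A)
    (hT : ∀ w, A * ‖w‖ ^ 2 ≤ ‖T w‖ ^ 2 ∧ ‖T w‖ ^ 2 ≤ B * ‖w‖ ^ 2) (w : H) :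
    A * ‖T w‖ ^ 2 ≤ ‖adjoint T (T w)‖ ^ 2 ∧ ‖adjoint T (T w)‖ ^ 2 ≤ B * ‖T w‖ ^ 2 := by
  set r := adjoint T (T w) with hr
  have hrw : ⟪r, w⟫ = ‖T w‖ ^ 2 := by
    rw [hr, adjoint_inner_left, real_inner_self_eq_norm_sq]
  have hrr : ⟪T w, T r⟫ = ‖r‖ ^ 2 := by
    rw [← adjoint_inner_left, ← hr, real_inner_self_eq_norm_sq]
  constructor
  · -- expand `0 ≤ ‖r - A • w‖²`
    have h := sq_nonneg ‖r - A • w‖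
    rw [norm_sub_sq_real, real_inner_smul_right, hrw, norm_smul, Real.norm_of_nonneg hA.le] at h
    nlinarith [(hT w).1]
  · have h := real_inner_le_norm (T w) (T r)
    rw [hrr] at h
    have h2 : (‖r‖ ^ 2) ^ 2 ≤ (‖T w‖ * ‖T r‖) ^ 2 := pow_le_pow_left₀ (sq_nonneg _) h 2
    rcases (sq_nonneg ‖r‖).eq_or_lt with h0 | h0
    · rcases (norm_nonneg w).eq_or_lt with hw | hw
      · have : w = 0 := norm_eq_zero.mp hw.symm
        simp [hr, this]
      · have hB : 0 ≤ B := by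
          by_contra! hB
          nlinarith [(hT w).2, sq_nonneg ‖T w‖, pow_pos hw 2]
        rw [← h0]
        positivity
    · have h3 : ‖r‖ ^ 2 * ‖r‖ ^ 2 ≤ (B * ‖T w‖ ^ 2) * ‖r‖ ^ 2 := by
        nlinarith [mul_le_mul_of_nonneg_left (hT r).2 (sq_nonneg ‖T w‖)]
      exact le_of_mul_le_mul_right h3 h0

open ContinuousLinearMap in
/-- The self-adjoint operator `T* T - (A + B) / 2` has norm at most `(B - A) / 2` with respect to
the norm `w ↦ ‖T w‖`. -/
theorem norm_map_adjoint_comp_sub_smul_le {H E : Type*} [NormedAddCommGroup H]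
    [InnerProductSpace ℝ H] [CompleteSpace H] [NormedAddCommGroup E] [InnerProductSpace ℝ E]
    [CompleteSpace E] (T : H →L[ℝ] E) {A B : ℝ} (hA : 0 < A) (hAB : A ≤ B)
    (hT : ∀ w, A * ‖w‖ ^ 2 ≤ ‖T w‖ ^ 2 ∧ ‖T w‖ ^ 2 ≤ B * ‖w‖ ^ 2) (u : H) :
    ‖T (adjoint T (T u) - ((A + B) / 2) • u)‖ ≤ (B - A) / 2 * ‖T u‖ := by
  set g := adjoint T (T u) - ((A + B) / 2) • u with hg
  -- polarization
  have key : ∀ s : ℝ, 4 * s * ‖T g‖ ^ 2 ≤ (B - A) * (‖T u‖ ^ 2 + s ^ 2 * ‖T g‖ ^ 2) := by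
    intro s
    have h1 := (norm_adjoint_comp_sq_bounds T hA hT (u + s • g)).2
    have h2 := (norm_adjoint_comp_sq_bounds T hA hT (u - s • g)).1
    have hi : ⟪adjoint T (T u), adjoint T (T g)⟫ = ‖T g‖ ^ 2 + (A + B) / 2 * ⟪T u, T g⟫ := by
      rw [adjoint_inner_right, ← real_inner_self_eq_norm_sq, ← real_inner_smul_left,
        ← inner_add_left, ← map_smul, ← map_add, hg, sub_add_cancel]
    simp only [map_add, map_sub, map_smul, norm_add_sq_real, norm_sub_sq_real,
      real_inner_smul_right, norm_smul, mul_pow, Real.norm_eq_abs, sq_abs, hi] at h1 h2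
    nlinarith
  refine abs_le_of_sq_le_sq' ?_ (by have := sub_nonneg.2 hAB; positivity) |>.2
  rcases hAB.eq_or_lt with h | h
  · have := key 1
    rw [h] at this ⊢
    nlinarith
  · have hk : 0 < B - A := sub_pos.2 h
    have := key (2 / (B - A))
    field_simp at this
    nlinarith

open ContinuousLinearMap in
/-- One exact line-search gradient step contracts the error `e` in the norm `w ↦ ‖T w‖` by the
factor `(B - A) / (B + A)`. -/
theorem norm_map_sub_greedy_step_le {H E : Type*} [NormedAddCommGroup H] [InnerProductSpace ℝ H]
    [CompleteSpace H] [NormedAddCommGroup E] [InnerProductSpace ℝ E] [CompleteSpace E]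
    (T : H →L[ℝ] E) {A B : ℝ} (hA : 0 < A) (hAB : A ≤ B)
    (hT : ∀ w, A * ‖w‖ ^ 2 ≤ ‖T w‖ ^ 2 ∧ ‖T w‖ ^ 2 ≤ B * ‖w‖ ^ 2) (e : H) :
    ‖T (e - (‖adjoint T (T e)‖ ^ 2 / ‖T (adjoint T (T e))‖ ^ 2) • adjoint T (T e))‖ ≤
      (B - A) / (B + A) * ‖T e‖ := by
  set r := adjoint T (T e) with hr
  have hexp : ∀ t : ℝ, ‖T (e - t • r)‖ ^ 2 =
      ‖T e‖ ^ 2 - 2 * t * ‖r‖ ^ 2 + t ^ 2 * ‖T r‖ ^ 2 := by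
    intro t
    have : ⟪T e, T r⟫ = ‖r‖ ^ 2 := by
      rw [← adjoint_inner_left, ← hr, real_inner_self_eq_norm_sq]
    rw [map_sub, map_smul, norm_sub_sq_real, real_inner_smul_right, this, norm_smul, mul_pow,
      Real.norm_eq_abs, sq_abs]
    ring
  have hmin : ‖T (e - (‖r‖ ^ 2 / ‖T r‖ ^ 2) • r)‖ ≤ ‖T (e - (2 / (A + B)) • r)‖ := by
    refine abs_le_of_sq_le_sq' ?_ (norm_nonneg _) |>.2
    rw [hexp, hexp]
    rcases (norm_nonneg (T r)).eq_or_lt with h0 | h0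
    · have hr0 : ‖r‖ ^ 2 = 0 := by
        have := (hT r).1
        rw [← h0] at this
        nlinarith [sq_nonneg ‖r‖]
      simp [← h0, hr0]
    · have hα : ‖r‖ ^ 2 / ‖T r‖ ^ 2 * ‖T r‖ ^ 2 = ‖r‖ ^ 2 := by field_simp
      generalize ‖r‖ ^ 2 / ‖T r‖ ^ 2 = α at hα ⊢
      rw [← hα]
      nlinarith [mul_nonneg (sq_nonneg (α - 2 / (A + B))) (sq_nonneg ‖T r‖)]
  refine hmin.trans ?_
  have hs : 0 < A + B := by linarith
  have h := norm_map_adjoint_comp_sub_smul_le T hA hAB hT e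
  rw [← hr] at h
  have he : e - (2 / (A + B)) • r = (-(2 / (A + B))) • (r - ((A + B) / 2) • e) := by
    rw [smul_sub, smul_smul, show -(2 / (A + B)) * ((A + B) / 2) = -1 by field_simp]
    module
  rw [he, map_smul, norm_smul, norm_neg, Real.norm_of_nonneg (by positivity)]
  calc 2 / (A + B) * ‖T (r - ((A + B) / 2) • e)‖
      ≤ 2 / (A + B) * ((B - A) / 2 * ‖T e‖) := by gcongr
    _ = (B - A) / (B + A) * ‖T e‖ := by rw [add_comm B A]; field_simp

open ContinuousLinearMap in
/-- A bounded operator that is bounded below admits least-squares solutions. -/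
theorem exists_adjoint_sub_map_eq_zero {H E : Type*} [NormedAddCommGroup H]
    [InnerProductSpace ℝ H] [CompleteSpace H] [NormedAddCommGroup E] [InnerProductSpace ℝ E]
    [CompleteSpace E] (T : H →L[ℝ] E) {A : ℝ} (hA : 0 < A)
    (hT : ∀ w, A * ‖w‖ ^ 2 ≤ ‖T w‖ ^ 2) (c : E) : ∃ z, adjoint T (c - T z) = 0 := by
  have hanti : AntilipschitzWith (Real.toNNReal (Real.sqrt A)⁻¹) T := by
    refine AddMonoidHomClass.antilipschitz_of_bound T fun w => ?_
    have hs : 0 < Real.sqrt A := Real.sqrt_pos.2 hA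
    rw [Real.coe_toNNReal _ (by positivity), inv_mul_eq_div, le_div_iff₀ hs]
    refine abs_le_of_sq_le_sq' ?_ (norm_nonneg _) |>.2
    rw [mul_pow, Real.sq_sqrt hA.le, mul_comm]
    exact hT w
  have hclosed : IsClosed (T.range : Set E) := by
    rw [LinearMap.coe_range]
    exact hanti.isClosed_range T.uniformContinuous
  have : CompleteSpace T.range := hclosed.completeSpace_coe
  obtain ⟨z, hz⟩ := T.range.starProjection_apply_mem c
  refine ⟨z, ext_inner_right ℝ fun v => ?_⟩
  rw [adjoint_inner_left, inner_zero_left]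
  have h := T.range.starProjection_inner_eq_zero c (T v) ⟨v, rfl⟩
  rw [← hz] at h
  exact h

/-- **Robustness of the greedy frame algorithm.**  Let `(xj j)_{j ∈ J}` be a frame for `H`
with bounds `0 < A ≤ B`, analysis operator `T : H → ℓ²(J)` and frame operator `S = T* T`.
Fix `x ∈ H`, `δ0 > 0` and noisy measurements `c ∈ ℓ²(J)` with `‖T x - c‖ ≤ δ0`.  Let
`y 0 = 0` and `y (n+1) = y n + αₙ • T* (c - T (y n))` with
`αₙ = ‖T* (c - T (y n))‖ ^ 2 / ‖T* (c - T (y n))‖_S ^ 2` (where `‖u‖_S ^ 2 = ⟪S u, u⟫`).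
Then for every `n ≥ 1`,
`‖x - y n‖_S ≤ ((B - A) / (B + A)) ^ n * (‖x‖_S + 2 * δ0) + 2 * δ0`. -/
theorem greedy_frame_algorithm_robust
    {H : Type*} [NormedAddCommGroup H] [InnerProductSpace ℝ H] [CompleteSpace H]
    {J : Type*} [Countable J] (xj : J → H)
    (A B : ℝ) (hA : 0 < A) (hAB : A ≤ B)
    (hframe : ∀ x : H,
      A * ‖x‖ ^ 2 ≤ ∑' j, ⟪x, xj j⟫ ^ 2 ∧ ∑' j, ⟪x, xj j⟫ ^ 2 ≤ B * ‖x‖ ^ 2)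
    (T : H →L[ℝ] lp (fun _ : J => ℝ) 2)
    (hT : ∀ (x : H) (j : J), T x j = ⟪x, xj j⟫)
    (S : H →L[ℝ] H) (hS : S = (ContinuousLinearMap.adjoint T).comp T)
    (x : H) (δ0 : ℝ) (hδ0 : 0 < δ0)
    (c : lp (fun _ : J => ℝ) 2) (hc : ‖T x - c‖ ≤ δ0)
    (y : ℕ → H) (hy0 : y 0 = 0)
    (hy : ∀ n : ℕ, y (n + 1) = y n +
      (‖ContinuousLinearMap.adjoint T (c - T (y n))‖ ^ 2 /
          ⟪S (ContinuousLinearMap.adjoint T (c - T (y n))),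
            ContinuousLinearMap.adjoint T (c - T (y n))⟫) •
        ContinuousLinearMap.adjoint T (c - T (y n))) :
    ∀ n : ℕ, 1 ≤ n →
      Real.sqrt ⟪S (x - y n), x - y n⟫ ≤
        ((B - A) / (B + A)) ^ n * (Real.sqrt ⟪S x, x⟫ + 2 * δ0) + 2 * δ0 := by
  have hST : ∀ w, ⟪S w, w⟫ = ‖T w‖ ^ 2 := fun w => by
    rw [hS, ContinuousLinearMap.comp_apply, ContinuousLinearMap.adjoint_inner_left,
      real_inner_self_eq_norm_sq]
  have hnorm : ∀ w, Real.sqrt ⟪S w, w⟫ = ‖T w‖ := fun w => by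
    rw [hST, Real.sqrt_sq (norm_nonneg _)]
  have hbound : ∀ w, A * ‖w‖ ^ 2 ≤ ‖T w‖ ^ 2 ∧ ‖T w‖ ^ 2 ≤ B * ‖w‖ ^ 2 := fun w => by
    have : ‖T w‖ ^ 2 = ∑' j, ⟪w, xj j⟫ ^ 2 := by
      rw [← real_inner_self_eq_norm_sq, lp.inner_eq_tsum]
      refine tsum_congr fun j => ?_
      rw [real_inner_self_eq_norm_sq, hT, Real.norm_eq_abs, sq_abs]
    rw [this]
    exact hframe w
  obtain ⟨z, hz⟩ := exists_adjoint_sub_map_eq_zero T hA (fun w => (hbound w).1) c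
  have hq : 0 ≤ (B - A) / (B + A) := div_nonneg (by linarith) (by linarith)
  have hstep : ∀ n, ‖T (z - y n)‖ ≤ ((B - A) / (B + A)) ^ n * ‖T z‖ := by
    intro n
    induction n with
    | zero => simp [hy0]
    | succ n ih =>
      have hres : ContinuousLinearMap.adjoint T (c - T (y n)) =
          ContinuousLinearMap.adjoint T (T (z - y n)) := by
        rw [← sub_add_sub_cancel c (T z) (T (y n)), map_add, hz, zero_add, map_sub T]
      rw [hy n, hST, hres, ← sub_sub, pow_succ' _ n, mul_assoc]
      exact (norm_map_sub_greedy_step_le T hA hAB hbound _).trans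
        (mul_le_mul_of_nonneg_left ih hq)
  have hxz : ‖T (x - z)‖ ≤ δ0 := by
    refine le_trans (abs_le_of_sq_le_sq' ?_ (norm_nonneg _)).2 hc
    have horth : ⟪T (x - z), c - T z⟫ = 0 := by
      rw [← ContinuousLinearMap.adjoint_inner_right, hz, inner_zero_right]
    have : T x - c = T (x - z) - (c - T z) := by rw [map_sub]; abel
    rw [this, norm_sub_sq_real, horth]
    nlinarith [sq_nonneg ‖c - T z‖]
  have hz_le : ‖T z‖ ≤ ‖T x‖ + δ0 := by
    have := norm_sub_le (T x) (T (x - z))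
    rw [← map_sub, sub_sub_cancel] at this
    linarith
  intro n _
  rw [hnorm, hnorm]
  calc ‖T (x - y n)‖ ≤ ‖T (x - z)‖ + ‖T (z - y n)‖ := by
        rw [← sub_add_sub_cancel x z (y n), map_add]
        exact norm_add_le _ _
    _ ≤ δ0 + ((B - A) / (B + A)) ^ n * ‖T z‖ := add_le_add hxz (hstep n)
    _ ≤ 2 * δ0 + ((B - A) / (B + A)) ^ n * (‖T x‖ + 2 * δ0) := by
        gcongr <;> linarith
    _ = _ := add_comm _ _
end
end

section
/- Let (x_j)_{j∈J} be a frame for H with frame bounds 0 < A ≤ B, analysis operator T, and frame operator S = T*T. Fix x ∈ H, δ₀ > 0, and c ∈ ℓ²(J) with ‖Tx − c‖ ≤ δ₀, and let x̃ ∈ H be the unique vector with Tx̃ = Pc, where P is the orthogonal projection onto the range of T. Define y₀ = 0 and, for n ≥ 0, α_n = ‖T*(c − Ty_n)‖² / ‖T*(c − Ty_n)‖_S² (when T*(c − Ty_n) ≠ 0) and y_{n+1} = y_n + α_n·T*(c − Ty_n). Then for every n ≥ 1, ‖x̃ − y_n‖_S ≤ ((B − A)/(B + A))^n · ‖x̃‖_S;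 that is, the noisy greedy iteration converges to x̃ at the guaranteed geometric rate in the S-norm. -/
noncomputable section

local notation "⟪" x ", " y "⟫" => @inner ℝ _ _ x y

/-- For symmetric `S` with `A ≤ S ≤ B`, the operator `S (B - S) (S - A)` is positive. -/
theorem inner_map_map_le_of_quadratic_bounds
    {H : Type*} [NormedAddCommGroup H] [InnerProductSpace ℝ H]
    {S : H →L[ℝ] H} (hsymm : ∀ u v : H, ⟪S u, v⟫ = ⟪u, S v⟫)
    {A B : ℝ} (hA : 0 < A) (hAB : A ≤ B)
    (hlow : ∀ u : H, A * ⟪u, u⟫ ≤ ⟪S u, u⟫) (hupp : ∀ u : H, ⟪S u, u⟫ ≤ B * ⟪u, u⟫)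
    (e : H) :
    ⟪S (S e), S e⟫ ≤ (A + B) * ⟪S e, S e⟫ - A * B * ⟪S e, e⟫ := by
  have h1 : ⟪S (S e), e⟫ = ⟪S e, S e⟫ := hsymm _ _
  have h2 : ⟪e, S e⟫ = ⟪S e, e⟫ := real_inner_comm _ _
  rcases hAB.eq_or_lt with rfl | hlt
  · have ha := le_antisymm (hupp e) (hlow e)
    have hb := le_antisymm (hupp (S e)) (hlow (S e))
    have hc := le_antisymm (hupp (e + S e)) (hlow (e + S e))
    simp only [map_add, inner_add_left, inner_add_right, h1, h2] at hc
    have h3 : ⟪S e, S e⟫ = A * ⟪S e, e⟫ := by linarith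
    rw [hb, h3]
    exact le_of_eq (by ring)
  · have hl := hlow (B • e - S e)
    have hu := hupp (S e - A • e)
    simp only [map_sub, map_smul, inner_sub_left, inner_sub_right, inner_smul_left,
      inner_smul_right, h1, h2, RCLike.conj_to_real] at hl hu
    have hB : 0 < B := hA.trans hlt
    have hl' := mul_le_mul_of_nonneg_left hl hA.le
    have hu' := mul_le_mul_of_nonneg_left hu hB.le
    refine le_of_mul_le_mul_left ?_ (sub_pos.mpr hlt)
    linarith

/-- One exact line-search gradient step contracts the `S`-norm by `(B - A) / (B + A)`. -/
theorem sqrt_inner_steepest_descent_step_le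
    {H : Type*} [NormedAddCommGroup H] [InnerProductSpace ℝ H]
    {S : H →L[ℝ] H} (hsymm : ∀ u v : H, ⟪S u, v⟫ = ⟪u, S v⟫)
    {A B : ℝ} (hA : 0 < A) (hAB : A ≤ B)
    (hlow : ∀ u : H, A * ⟪u, u⟫ ≤ ⟪S u, u⟫) (hupp : ∀ u : H, ⟪S u, u⟫ ≤ B * ⟪u, u⟫)
    (e : H) :
    Real.sqrt ⟪S (e - (‖S e‖ ^ 2 / ⟪S (S e), S e⟫) • S e),
        e - (‖S e‖ ^ 2 / ⟪S (S e), S e⟫) • S e⟫ ≤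
      (B - A) / (B + A) * Real.sqrt ⟪S e, e⟫ := by
  have hB : 0 < B := hA.trans_le hAB
  have hrate : 0 ≤ (B - A) / (B + A) := div_nonneg (sub_nonneg.mpr hAB) (by positivity)
  by_cases hSe : S e = 0
  · simp [hSe]
  have h1 : ⟪S (S e), e⟫ = ⟪S e, S e⟫ := hsymm _ _
  have hR : 0 < ⟪S e, S e⟫ := real_inner_self_pos.mpr hSe
  have hQ : 0 < ⟪S (S e), S e⟫ := (mul_pos hA hR).trans_le (hlow _)
  have hE := inner_map_map_le_of_quadratic_bounds hsymm hA hAB hlow hupp e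
  rw [← real_inner_self_eq_norm_sq]
  have hexp : ⟪S (e - (⟪S e, S e⟫ / ⟪S (S e), S e⟫) • S e),
      e - (⟪S e, S e⟫ / ⟪S (S e), S e⟫) • S e⟫ =
        ⟪S e, e⟫ - ⟪S e, S e⟫ ^ 2 / ⟪S (S e), S e⟫ := by
    simp only [map_sub, map_smul, inner_sub_left, inner_sub_right, inner_smul_left,
      inner_smul_right, h1, RCLike.conj_to_real]
    field_simp
    ring
  rw [hexp, ← Real.sqrt_sq hrate, ← Real.sqrt_mul (sq_nonneg _)]
  apply Real.sqrt_le_sqrt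
  generalize ⟪S (S e), S e⟫ = Q at *
  generalize ⟪S e, S e⟫ = R at *
  generalize ⟪S e, e⟫ = E at *
  have hkey : 4 * A * B * E * Q ≤ (A + B) ^ 2 * R ^ 2 := by
    nlinarith [mul_le_mul_of_nonneg_right hE hQ.le, sq_nonneg ((A + B) * R - 2 * Q)]
  have hdiff : ((B - A) / (B + A)) ^ 2 * E - (E - R ^ 2 / Q) =
      ((A + B) ^ 2 * R ^ 2 - 4 * A * B * E * Q) / ((B + A) ^ 2 * Q) := by
    field_simp
    ring
  have := div_nonneg (sub_nonneg.mpr hkey) (by positivity : 0 ≤ (B + A) ^ 2 * Q)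
  linarith

/-- **Geometric convergence of the noisy greedy iteration.**  Let `(xj j)_{j ∈ J}` be a
frame for `H` with bounds `0 < A ≤ B`, analysis operator `T` and frame operator
`S = T* T`.  Fix `x ∈ H`, `δ0 > 0` and `c ∈ ℓ²(J)` with `‖T x - c‖ ≤ δ0`, and let `xt`
be the vector with `T xt = P c`, `P` the orthogonal projection onto the range of `T`
(characterized by `c - T xt ⊥ range T`).  Let `y 0 = 0` and
`y (n+1) = y n + αₙ • T* (c - T (y n))` with
`αₙ = ‖T* (c - T (y n))‖ ^ 2 / ‖T* (c - T (y n))‖_S ^ 2` (where `‖u‖_S ^ 2 = ⟪S u, u⟫`).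
Then for every `n ≥ 1`, `‖xt - y n‖_S ≤ ((B - A) / (B + A)) ^ n * ‖xt‖_S`. -/
theorem noisy_greedy_iteration_geometric_rate
    {H : Type*} [NormedAddCommGroup H] [InnerProductSpace ℝ H] [CompleteSpace H]
    {J : Type*} [Countable J] (xj : J → H)
    (A B : ℝ) (hA : 0 < A) (hAB : A ≤ B)
    (hframe : ∀ x : H,
      A * ‖x‖ ^ 2 ≤ ∑' j, ⟪x, xj j⟫ ^ 2 ∧ ∑' j, ⟪x, xj j⟫ ^ 2 ≤ B * ‖x‖ ^ 2)
    (T : H →L[ℝ] lp (fun _ : J => ℝ) 2)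
    (hT : ∀ (x : H) (j : J), T x j = ⟪x, xj j⟫)
    (S : H →L[ℝ] H) (hS : S = (ContinuousLinearMap.adjoint T).comp T)
    (x : H) (δ0 : ℝ) (hδ0 : 0 < δ0)
    (c : lp (fun _ : J => ℝ) 2) (hc : ‖T x - c‖ ≤ δ0)
    (xt : H) (hxt : ∀ z : H, ⟪c - T xt, T z⟫ = 0)
    (y : ℕ → H) (hy0 : y 0 = 0)
    (hy : ∀ n : ℕ, y (n + 1) = y n +
      (‖ContinuousLinearMap.adjoint T (c - T (y n))‖ ^ 2 /
          ⟪S (ContinuousLinearMap.adjoint T (c - T (y n))),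
            ContinuousLinearMap.adjoint T (c - T (y n))⟫) •
        ContinuousLinearMap.adjoint T (c - T (y n))) :
    ∀ n : ℕ, 1 ≤ n →
      Real.sqrt ⟪S (xt - y n), xt - y n⟫ ≤
        ((B - A) / (B + A)) ^ n * Real.sqrt ⟪S xt, xt⟫ := by
  have hSinner (u v : H) : ⟪S u, v⟫ = ⟪T u, T v⟫ := by
    rw [hS, ContinuousLinearMap.comp_apply, ContinuousLinearMap.adjoint_inner_left]
  have hsymm (u v : H) : ⟪S u, v⟫ = ⟪u, S v⟫ := by
    rw [hSinner, real_inner_comm (S v), hSinner, real_inner_comm]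
  have hsum (u : H) : ⟪S u, u⟫ = ∑' j, ⟪u, xj j⟫ ^ 2 := by
    rw [hSinner, lp.inner_eq_tsum]
    exact tsum_congr fun j => by rw [real_inner_self_eq_norm_sq, hT, Real.norm_eq_abs, sq_abs]
  have hlow (u : H) : A * ⟪u, u⟫ ≤ ⟪S u, u⟫ := by
    rw [hsum, real_inner_self_eq_norm_sq]
    exact (hframe u).1
  have hupp (u : H) : ⟪S u, u⟫ ≤ B * ⟪u, u⟫ := by
    rw [hsum, real_inner_self_eq_norm_sq]
    exact (hframe u).2
  have hres (n : ℕ) : ContinuousLinearMap.adjoint T (c - T (y n)) = S (xt - y n) := by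
    refine ext_inner_right ℝ fun z => ?_
    rw [ContinuousLinearMap.adjoint_inner_left, hSinner, map_sub,
      ← sub_add_sub_cancel c (T xt) (T (y n)), inner_add_left, hxt, zero_add]
  have hrate : 0 ≤ (B - A) / (B + A) := div_nonneg (sub_nonneg.mpr hAB) (by linarith)
  suffices h : ∀ n, Real.sqrt ⟪S (xt - y n), xt - y n⟫ ≤
      ((B - A) / (B + A)) ^ n * Real.sqrt ⟪S xt, xt⟫ from fun n _ => h n
  intro n
  induction n with
  | zero => simp [hy0]
  | succ n ih =>
    have hstep := sqrt_inner_steepest_descent_step_le hsymm hA hAB hlow hupp (xt - y n)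
    rw [hy, hres, ← sub_sub, pow_succ' _ n, mul_assoc]
    exact hstep.trans (mul_le_mul_of_nonneg_left ih hrate)
end
end
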